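/- arXiv:2507.11922 — 2 statements merged into one kernel-verified Lean document; each statement's English description precedes it below -/
import Mathlib

section
/- Fix θ ∈ [0,1] and α ∈ (0,1). Consider a model with m variables and s = |I_1| signal variables, and positive constants c_{m,θ}, c_{m−s,θ} satisfying: (i) m·c_{m,θ} ≥ (m−s)·c_{m−s,θ}; and (ii) for a null vector x⁰' ~ N(0, Σ_{I_0}) of dimension m−s, where Σ_{I_0} is the principal submatrix of Σ on the index set I_0, one has P(V_{m−s,θ}(x⁰') > c_{m−s,θ}) < α. Then the estimator computed from X satisfies P(π̂_θ(X; c_{m,θ}) ≤ π) > 1 − α. -/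
open MeasureTheory ProbabilityTheory Filter

noncomputable section

/-- Standard normal CDF `Φ`. -/
def Phi (t : ℝ) : ℝ := ((gaussianReal 0 1) (Set.Iic t)).toReal

/-- Standard normal upper tail `Φ̄(t) = 1 − Φ(t)`. -/
def PhiBar (t : ℝ) : ℝ := 1 - Phi t

/-- Standard normal density `φ`. -/
def stdPhi (t : ℝ) : ℝ := Real.exp (-(t ^ 2) / 2) / Real.sqrt (2 * Real.pi)

/-- Positive part `[x]₊`. -/
def posPart' (x : ℝ) : ℝ := max x 0

/-- A correlation matrix: symmetric positive semidefinite with unit diagonal. -/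
def IsCorrMatrix {ι : Type*} [Fintype ι] (S : Matrix ι ι ℝ) : Prop :=
  S.PosSemidef ∧ ∀ i, S i i = 1

/-- `X` is a Gaussian random vector with mean `μ` and covariance `S`:
every linear functional of `X` has the corresponding one-dimensional Gaussian law. -/
def HasLawGaussian {Ω : Type*} [MeasureSpace Ω] {ι : Type*} [Fintype ι]
    (X : Ω → ι → ℝ) (μ : ι → ℝ) (S : Matrix ι ι ℝ) : Prop :=
  (∀ i, Measurable fun ω => X ω i) ∧
  ∀ c : ι → ℝ,
    Measure.map (fun ω => ∑ i, c i * X ω i) volume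
      = gaussianReal (∑ i, c i * μ i) (∑ i, ∑ j, c i * S i j * c j).toNNReal

/-- number of exceedances `Σ_i 1{x_i > t}` (as a real number). -/
def exceedCount {ι : Type*} [Fintype ι] (x : ι → ℝ) (t : ℝ) : ℝ :=
  ∑ i, if t < x i then (1 : ℝ) else 0

/-- the quantity inside the supremum defining `π̂_θ(x; c)`. -/
def piHatTerm {ι : Type*} [Fintype ι] (θ c : ℝ) (x : ι → ℝ) (t : ℝ) : ℝ :=
  ((Fintype.card ι : ℝ)⁻¹ * exceedCount x t - PhiBar t - c * PhiBar t ^ θ) / (1 - PhiBar t)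

/-- the estimator `π̂_θ(x; c) = sup_{t>0} [...]`. -/
def piHat {ι : Type*} [Fintype ι] (θ c : ℝ) (x : ι → ℝ) : ℝ :=
  sSup {y : ℝ | ∃ t : ℝ, 0 < t ∧ y = piHatTerm θ c x t}

/-- the quantity inside the supremum defining `V_{n,θ}(x⁰)`. -/
def VTerm {ι : Type*} [Fintype ι] (θ : ℝ) (x : ι → ℝ) (t : ℝ) : ℝ :=
  |(Fintype.card ι : ℝ)⁻¹ * exceedCount x t - PhiBar t| / PhiBar t ^ θ

/-- the statistic `V_{n,θ}(x⁰) = sup_{t>0} |...| / Φ̄(t)^θ`. -/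
def Vstat {ι : Type*} [Fintype ι] (θ : ℝ) (x : ι → ℝ) : ℝ :=
  sSup {y : ℝ | ∃ t : ℝ, 0 < t ∧ y = VTerm θ x t}

/-- the discretization grid `𝕋 = [√(log log m), √(5 log m)] ∩ ℕ`. -/
def TT (m : ℕ) : Finset ℕ :=
  (Finset.range (m + 1)).filter
    (fun t => Real.sqrt (Real.log (Real.log (m : ℝ))) ≤ (t : ℝ) ∧
      (t : ℝ) ≤ Real.sqrt (5 * Real.log (m : ℝ)))

/-- the discretization grid `𝕋' = [√lo, √(5 log m)] ∩ ℕ` with a general lower endpoint `√lo`. -/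
def TTlo (m : ℕ) (lo : ℝ) : Finset ℕ :=
  (Finset.range (m + 1)).filter
    (fun t => Real.sqrt lo ≤ (t : ℝ) ∧ (t : ℝ) ≤ Real.sqrt (5 * Real.log (m : ℝ)))

/-- maximum of `f` over a finite grid (as `sSup` of the image, `= 0` for the empty grid). -/
def gridMax (S : Finset ℕ) (f : ℝ → ℝ) : ℝ :=
  sSup {y : ℝ | ∃ t ∈ S, y = f (t : ℝ)}

/-- the discretized estimator `π̂*_θ(x; c) = max_{t ∈ 𝕋} [...]`. -/
def piHatStar {ι : Type*} [Fintype ι] (m : ℕ) (θ c : ℝ) (x : ι → ℝ) : ℝ :=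
  gridMax (TT m) (piHatTerm θ c x)

/-- the discretized statistic `V*_{n,θ}(x⁰) = max_{t ∈ 𝕋} |...| / Φ̄(t)^θ`. -/
def VstatStar {ι : Type*} [Fintype ι] (m : ℕ) (θ : ℝ) (x : ι → ℝ) : ℝ :=
  gridMax (TT m) (VTerm θ x)

/-- probability of an event, as a real number. -/
def Pr {Ω : Type*} [MeasureSpace Ω] (A : Set Ω) : ℝ := (volume A).toReal

/-- conditional probability `P(A | E)`, as a real number. -/
def PrCond {Ω : Type*} [MeasureSpace Ω] (E A : Set Ω) : ℝ :=
  ((ProbabilityTheory.cond volume E) A).toReal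



theorem Phi_eq_cdf (t : ℝ) : Phi t = cdf (gaussianReal 0 1) t := by
  rw [cdf_eq_real]; rfl

theorem PhiBar_eq (t : ℝ) : PhiBar t = ((gaussianReal 0 1) (Set.Ioi t)).toReal := by
  have h := prob_compl_eq_one_sub (μ := gaussianReal 0 1) (measurableSet_Iic (a := t))
  rw [Set.compl_Iic] at h
  rw [h, ENNReal.toReal_sub_of_le prob_le_one ENNReal.one_ne_top]
  rfl

theorem gauss_pos {U : Set ℝ} (hU : volume U ≠ 0) : 0 < ((gaussianReal 0 1) U).toReal := by
  apply ENNReal.toReal_pos _ (measure_ne_top _ _)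
  intro h
  exact hU (gaussianReal_absolutelyContinuous' 0 one_ne_zero h)

theorem PhiBar_pos (t : ℝ) : 0 < PhiBar t := by
  rw [PhiBar_eq]; exact gauss_pos (by simp)

theorem Phi_pos (t : ℝ) : 0 < Phi t := gauss_pos (by simp)

theorem PhiBar_lt_one (t : ℝ) : PhiBar t < 1 := by
  have := Phi_pos t
  unfold PhiBar; linarith

theorem PhiBar_anti : Antitone PhiBar := by
  intro a b h
  unfold PhiBar
  rw [Phi_eq_cdf, Phi_eq_cdf]
  have := monotone_cdf (gaussianReal 0 1) h
  linarith

theorem PhiBar_rc (t : ℝ) : ContinuousWithinAt PhiBar (Set.Ici t) t := by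
  have h := (cdf (gaussianReal 0 1)).right_continuous t
  have : PhiBar = fun t => 1 - cdf (gaussianReal 0 1) t := by
    funext t; simp [PhiBar, Phi_eq_cdf]
  rw [this]
  exact continuousWithinAt_const.sub h

section helpers
variable {ι : Type*} [Fintype ι]

theorem exceed_nonneg (x : ι → ℝ) (t : ℝ) : 0 ≤ exceedCount x t := by
  unfold exceedCount
  exact Finset.sum_nonneg (fun i _ => by split_ifs <;> norm_num)

theorem exceed_le (x : ι → ℝ) (t : ℝ) : exceedCount x t ≤ Fintype.card ι := by
  unfold exceedCount
  calc _ ≤ ∑ i : ι, (1:ℝ) := Finset.sum_le_sum (fun i _ => by split_ifs <;> norm_num)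
    _ = _ := by simp

theorem inv_exceed_le (x : ι → ℝ) (t : ℝ) :
    (Fintype.card ι : ℝ)⁻¹ * exceedCount x t ≤ 1 := by
  have h := exceed_le x t
  calc _ ≤ (Fintype.card ι : ℝ)⁻¹ * Fintype.card ι := by gcongr
    _ ≤ 1 := inv_mul_le_one

theorem inv_exceed_nonneg (x : ι → ℝ) (t : ℝ) :
    0 ≤ (Fintype.card ι : ℝ)⁻¹ * exceedCount x t :=
  mul_nonneg (by positivity) (exceed_nonneg x t)

theorem exceed_rc (x : ι → ℝ) (t : ℝ) : ContinuousWithinAt (exceedCount x) (Set.Ici t) t := by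
  unfold exceedCount
  refine tendsto_finsetSum _ (fun i _ => ?_)
  by_cases h : t < x i
  · apply tendsto_const_nhds.congr'
    have : ∀ᶠ u in nhdsWithin t (Set.Ici t), u < x i :=
      mem_nhdsWithin_of_mem_nhds (Iio_mem_nhds h)
    filter_upwards [this] with u hu
    simp [h, hu]
  · apply tendsto_const_nhds.congr'
    filter_upwards [self_mem_nhdsWithin] with u hu
    have : ¬ u < x i := by
      have : t ≤ u := hu
      linarith
    simp [h, this]

theorem VTerm_rc (θ : ℝ) (x : ι → ℝ) (t : ℝ) :
    ContinuousWithinAt (VTerm θ x) (Set.Ici t) t := by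
  unfold VTerm
  refine ContinuousWithinAt.div ?_ ?_ (Real.rpow_pos_of_pos (PhiBar_pos t) θ).ne'
  · exact ((continuousWithinAt_const.mul (exceed_rc x t)).sub (PhiBar_rc t)).abs
  · exact (PhiBar_rc t).rpow_const (Or.inl (PhiBar_pos t).ne')

theorem V_bdd {θ : ℝ} (hθ : θ ∈ Set.Icc (0:ℝ) 1) (x : ι → ℝ) :
    BddAbove {y : ℝ | ∃ t : ℝ, 0 < t ∧ y = VTerm θ x t} := by
  obtain ⟨M, hM⟩ := (Set.finite_range x).bddAbove
  refine ⟨max 1 (1 / PhiBar M ^ θ), ?_⟩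
  rintro y ⟨t, ht, rfl⟩
  have hp := PhiBar_pos t
  have hp1 := PhiBar_lt_one t
  rcases le_total M t with h | h
  · apply le_max_of_le_left
    have : exceedCount x t = 0 := by
      unfold exceedCount
      apply Finset.sum_eq_zero
      intro i _
      have : x i ≤ M := hM ⟨i, rfl⟩
      simp; linarith
    unfold VTerm
    rw [this, mul_zero, zero_sub, abs_neg, abs_of_pos hp, div_le_one (by positivity)]
    exact Real.self_le_rpow_of_le_one hp.le hp1.le hθ.2
  · apply le_max_of_le_right
    unfold VTerm
    have h1 := inv_exceed_le x t
    have h2 := inv_exceed_nonneg x t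
    have h3 := PhiBar_pos M
    apply div_le_div₀ zero_le_one _ (by positivity)
    · exact Real.rpow_le_rpow h3.le (PhiBar_anti h) hθ.1
    · rw [abs_le]; constructor <;> linarith

theorem lt_V_iff {θ : ℝ} (hθ : θ ∈ Set.Icc (0:ℝ) 1) (x : ι → ℝ) (c : ℝ) :
    c < Vstat θ x ↔ ∃ q : ℚ, (0:ℝ) < q ∧ c < VTerm θ x q := by
  unfold Vstat
  rw [lt_csSup_iff (V_bdd hθ x) ⟨_, 1, one_pos, rfl⟩]
  constructor
  · rintro ⟨_, ⟨t, ht, rfl⟩, h⟩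
    have h1 : ∀ᶠ u in nhdsWithin t (Set.Ici t), c < VTerm θ x u :=
      (VTerm_rc θ x t).eventually (lt_mem_nhds h)
    obtain ⟨u, hu, hu2⟩ := (mem_nhdsGE_iff_exists_Ico_subset).1 h1
    obtain ⟨q, hq1, hq2⟩ := exists_rat_btwn (show t < u from hu)
    exact ⟨q, ht.trans hq1, hu2 ⟨hq1.le, hq2⟩⟩
  · rintro ⟨q, hq, h⟩
    exact ⟨_, ⟨q, hq, rfl⟩, h⟩

theorem meas_V {θ : ℝ} (hθ : θ ∈ Set.Icc (0:ℝ) 1) (c : ℝ) :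
    MeasurableSet {x : ι → ℝ | c < Vstat θ x} := by
  simp only [lt_V_iff hθ]
  simp only [Set.ofPred_exists, Set.ofPred_and]
  refine MeasurableSet.iUnion fun q => (MeasurableSet.const _).inter ?_
  apply measurableSet_lt measurable_const
  unfold VTerm exceedCount
  refine Measurable.div_const ?_ _
  apply Measurable.abs
  apply Measurable.sub_const
  apply Measurable.const_mul
  refine Finset.measurable_fun_sum _ fun i _ => ?_
  exact Measurable.ite (measurableSet_lt measurable_const (measurable_pi_apply i))
    measurable_const measurable_const

theorem law_unique {Ω : Type*} [MeasureSpace Ω] [IsProbabilityMeasure (volume : Measure Ω)]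
    {X Y : Ω → ι → ℝ} {μ : ι → ℝ} {S : Matrix ι ι ℝ}
    (hX : HasLawGaussian X μ S) (hY : HasLawGaussian Y μ S) :
    Measure.map X volume = Measure.map Y volume := by
  classical
  have mX : Measurable X := measurable_pi_lambda _ hX.1
  have mY : Measurable Y := measurable_pi_lambda _ hY.1
  have := Measure.isProbabilityMeasure_map (μ := (volume : Measure Ω)) mX.aemeasurable
  have := Measure.isProbabilityMeasure_map (μ := (volume : Measure Ω)) mY.aemeasurable
  apply Measure.ext_of_charFunDual
  funext L
  rw [charFunDual_eq_charFun_map_one, charFunDual_eq_charFun_map_one]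
  congr 1
  have hL : ∀ x : ι → ℝ, L x = ∑ i, L (Pi.single i 1) * x i := by
    intro x
    conv_lhs => rw [pi_eq_sum_univ' x]
    rw [map_sum]
    refine Finset.sum_congr rfl fun i _ => ?_
    rw [map_smul, smul_eq_mul, mul_comm]
  rw [Measure.map_map (by fun_prop) mX, Measure.map_map (by fun_prop) mY]
  have e : ∀ Z : Ω → ι → ℝ, (L ∘ Z) = fun ω => ∑ i, L (Pi.single i 1) * Z ω i :=
    fun Z => funext fun ω => hL _
  rw [e, e, hX.2, hY.2]

theorem det_bound {θ : ℝ} (hθ : θ ∈ Set.Icc (0:ℝ) 1) {m : ℕ} (hm : 0 < m) (μ : Fin m → ℝ)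
    (s : ℕ) (hs : s = (Finset.univ.filter (fun i => μ i ≠ 0)).card)
    (cm cms : ℝ) (hmono : ((m : ℝ) - s) * cms ≤ (m : ℝ) * cm) (x : Fin m → ℝ)
    (hV : Vstat θ (fun i : {i : Fin m // μ i = 0} => x i.1) ≤ cms) :
    piHat θ cm x ≤ (s : ℝ) / m := by
  unfold piHat
  refine csSup_le (Set.nonempty_of_mem (x := piHatTerm θ cm x 1) ⟨1, one_pos, rfl⟩) ?_
  rintro _ ⟨t, ht, rfl⟩
  have hp := PhiBar_pos t
  have hp1 := PhiBar_lt_one t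
  have hm' : (0:ℝ) < m := by exact_mod_cast hm
  have hpt : 0 < PhiBar t ^ θ := by positivity
  set y : {i : Fin m // μ i = 0} → ℝ := fun i => x i.1 with hy
  have hVt : VTerm θ y t ≤ cms := (le_csSup (V_bdd hθ y) ⟨t, ht, rfl⟩).trans hV
  have hcardN : s + Fintype.card {i : Fin m // μ i = 0} = m := by
    rw [hs, Fintype.card_subtype, add_comm]
    have := Finset.card_filter_add_card_filter_not (s := (Finset.univ : Finset (Fin m)))
      (fun i => μ i = 0)
    simpa using this
  have hcard : (Fintype.card {i : Fin m // μ i = 0} : ℝ) = m - s := by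
    have h : (s:ℝ) + (Fintype.card {i : Fin m // μ i = 0} : ℝ) = m := by exact_mod_cast hcardN
    linarith
  have hsplit : exceedCount x t ≤ s + exceedCount y t := by
    unfold exceedCount
    rw [← Finset.sum_filter_not_add_sum_filter Finset.univ (fun i => μ i = 0)]
    apply add_le_add
    · calc _ ≤ ∑ i ∈ Finset.univ.filter (fun i => ¬ μ i = 0), (1:ℝ) :=
          Finset.sum_le_sum (fun i _ => by split_ifs <;> norm_num)
        _ = s := by simp [hs]
    · rw [Finset.sum_subtype (p := fun i => μ i = 0) _ (by simp)]
  have hnull : exceedCount y t ≤ (m - s) * (PhiBar t + cms * PhiBar t ^ θ) := by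
    unfold VTerm at hVt
    rw [div_le_iff₀ hpt] at hVt
    have h1 := (abs_le.1 hVt).2
    have h2 : (Fintype.card {i : Fin m // μ i = 0} : ℝ)⁻¹ * exceedCount y t
      ≤ PhiBar t + cms * PhiBar t ^ θ := by linarith
    rw [← hcard]
    rcases Nat.eq_zero_or_pos (Fintype.card {i : Fin m // μ i = 0}) with h0 | h0
    · have := exceed_le y t
      rw [h0] at this ⊢
      simpa using this
    · rwa [inv_mul_le_iff₀ (by exact_mod_cast h0)] at h2
  unfold piHatTerm
  rw [div_le_div_iff₀ (by linarith) hm', Fintype.card_fin]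
  have h3 := mul_le_mul_of_nonneg_right hmono hpt.le
  have h4 : ((m:ℝ)⁻¹ * exceedCount x t - PhiBar t - cm * PhiBar t ^ θ) * m
    = exceedCount x t - m * PhiBar t - m * cm * PhiBar t ^ θ := by field_simp
  rw [h4]
  nlinarith

end helpers

theorem restrict_law {Ω : Type*} [MeasureSpace Ω] {ι : Type*} [Fintype ι]
    {X : Ω → ι → ℝ} {μ : ι → ℝ} {S : Matrix ι ι ℝ} [DecidablePred fun i => μ i = 0]
    (hX : HasLawGaussian X μ S) :
    HasLawGaussian (fun ω (i : {i : ι // μ i = 0}) => X ω i.1) 0 (fun i j => S i.1 j.1) := by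
  refine ⟨fun i => hX.1 _, fun c => ?_⟩
  have h := hX.2 (fun i => if h : μ i = 0 then c ⟨i, h⟩ else 0)
  have key : ∀ f : ι → ℝ, ∑ i, (if h : μ i = 0 then c ⟨i, h⟩ else 0) * f i
      = ∑ i : {i : ι // μ i = 0}, c i * f i.1 := by
    intro f
    rw [← Finset.sum_filter_add_sum_filter_not Finset.univ (fun i => μ i = 0)]
    rw [Finset.sum_subtype (p := fun i => μ i = 0) _ (by simp)]
    rw [Finset.sum_eq_zero (s := Finset.univ.filter (fun i => ¬ μ i = 0)), add_zero]
    · refine Finset.sum_congr rfl fun i _ => ?_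
      rw [dif_pos i.2]
    · intro i hi
      rw [Finset.mem_filter] at hi
      rw [dif_neg hi.2, zero_mul]
  have key2 : ∑ i, ∑ j, (if h : μ i = 0 then c ⟨i, h⟩ else 0) * S i j *
      (if h : μ j = 0 then c ⟨j, h⟩ else 0)
      = ∑ i : {i : ι // μ i = 0}, ∑ j : {i : ι // μ i = 0}, c i * S i.1 j.1 * c j := by
    simp only [mul_assoc, ← Finset.mul_sum]
    rw [key]
    refine Finset.sum_congr rfl fun i _ => ?_
    congr 1
    simp only [mul_comm (S _ _)]
    rw [key]
  rw [key2] at h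
  simp only [key] at h
  rw [h]
  congr 1
  refine Finset.sum_congr rfl fun i _ => ?_
  simp [i.2]

/-- lower bound property of `π̂_θ` (Lemma A.1). -/
theorem stmt0
    {Ω : Type} [MeasureSpace Ω] [IsProbabilityMeasure (volume : Measure Ω)]
    (θ α : ℝ) (hθ : θ ∈ Set.Icc (0:ℝ) 1) (hα : α ∈ Set.Ioo (0:ℝ) 1)
    (m : ℕ) (hm : 0 < m)
    (μ : Fin m → ℝ) (S : Matrix (Fin m) (Fin m) ℝ) (hS : IsCorrMatrix S)
    (X : Ω → Fin m → ℝ) (hX : HasLawGaussian X μ S)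
    (s : ℕ) (hs : s = (Finset.univ.filter (fun i => μ i ≠ 0)).card)
    (cm cms : ℝ) (hcm : 0 < cm) (hcms : 0 < cms)
    (hmono : ((m : ℝ) - s) * cms ≤ (m : ℝ) * cm)
    (x0 : Ω → {i : Fin m // μ i = 0} → ℝ)
    (hx0 : HasLawGaussian x0 0 (fun i j => S i.1 j.1))
    (hnull : Pr {ω | cms < Vstat θ (x0 ω)} < α) :
    1 - α < Pr {ω | piHat θ cm (X ω) ≤ (s : ℝ) / m} := by
  have hR := restrict_law hX
  have hlaw := law_unique hR hx0
  have mR : Measurable (fun ω (i : {i : Fin m // μ i = 0}) => X ω i.1) :=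
    measurable_pi_lambda _ hR.1
  have mx : Measurable x0 := measurable_pi_lambda _ hx0.1
  have hA := meas_V (ι := {i : Fin m // μ i = 0}) hθ cms
  have e1 := Measure.map_apply (μ := volume) mR hA
  rw [hlaw, Measure.map_apply mx hA] at e1
  have hlt : Pr ((fun ω (i : {i : Fin m // μ i = 0}) => X ω i.1) ⁻¹'
      {x | cms < Vstat θ x}) < α := by
    unfold Pr
    rw [← e1]
    exact hnull
  have hsub : ((fun ω (i : {i : Fin m // μ i = 0}) => X ω i.1) ⁻¹'
      {x | cms < Vstat θ x})ᶜ ⊆ {ω | piHat θ cm (X ω) ≤ (s : ℝ) / m} := by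
    intro ω hω
    exact det_bound hθ hm μ s hs cm cms hmono (X ω) (not_lt.1 hω)
  have h1 : Pr ((fun ω (i : {i : Fin m // μ i = 0}) => X ω i.1) ⁻¹'
      {x | cms < Vstat θ x})ᶜ ≤ Pr {ω | piHat θ cm (X ω) ≤ (s : ℝ) / m} :=
    ENNReal.toReal_mono (measure_ne_top _ _) (measure_mono hsub)
  have h2 : Pr ((fun ω (i : {i : Fin m // μ i = 0}) => X ω i.1) ⁻¹'
      {x | cms < Vstat θ x})ᶜ = 1 - Pr ((fun ω (i : {i : Fin m // μ i = 0}) => X ω i.1) ⁻¹'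
      {x | cms < Vstat θ x}) := by
    unfold Pr
    rw [prob_compl_eq_one_sub (mR hA),
      ENNReal.toReal_sub_of_le prob_le_one ENNReal.one_ne_top]
    rfl
  linarith

end
end

section
/- There exists a universal constant C such that for every integer m ≥ 1, every m×m correlation matrix Σ, every t ≥ 0, and x⁰ ~ N(0, Σ): Var( Σ_{i=1}^m 1{x_i⁰ > t} ) ≤ C · ( Σ_{i=1}^m Σ_{j=1}^m |Σ_ij| ) · e^{−t²/2}. -/
open MeasureTheory ProbabilityTheory Filter

noncomputable section

lemma aux_pdf (x : ℝ) : gaussianPDFReal 0 1 x = (Real.sqrt (2 * Real.pi))⁻¹ * Real.exp (-x^2/2) := by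
  simp [gaussianPDFReal]

lemma aux_inv : (Real.sqrt (2 * Real.pi))⁻¹ ≤ 1 := by
  apply inv_le_one_of_one_le₀
  rw [Real.one_le_sqrt]
  nlinarith [Real.pi_gt_three]

lemma aux_pdf_le (x : ℝ) : gaussianPDFReal 0 1 x ≤ 1 := by
  rw [aux_pdf]
  have h1 : Real.exp (-x^2/2) ≤ 1 := by
    rw [Real.exp_le_one_iff]; nlinarith [sq_nonneg x]
  exact mul_le_one₀ aux_inv (Real.exp_pos _).le h1

lemma aux_lip' {u v : ℝ} (h : u ≤ v) :
    |(gaussianReal 0 1).real (Set.Ioi u) - (gaussianReal 0 1).real (Set.Ioi v)| ≤ v - u := by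
  have h1 : (gaussianReal 0 1).real (Set.Ioi u) =
      (gaussianReal 0 1).real (Set.Ioc u v) + (gaussianReal 0 1).real (Set.Ioi v) := by
    rw [← measureReal_union _ measurableSet_Ioi, Set.Ioc_union_Ioi_eq_Ioi h]
    exact Set.disjoint_left.mpr fun x hx hx' => not_lt.mpr hx.2 hx'
  have h2 : (gaussianReal 0 1) (Set.Ioc u v) ≤ ENNReal.ofReal (v - u) := by
    rw [gaussianReal_apply 0 one_ne_zero]
    calc _ ≤ ∫⁻ x in Set.Ioc u v, 1 := by
          apply lintegral_mono
          intro x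
          simp only [gaussianPDF]
          exact ENNReal.ofReal_le_one.mpr (aux_pdf_le x)
      _ = _ := by simp
  have h3 : (gaussianReal 0 1).real (Set.Ioc u v) ≤ v - u :=
    ENNReal.toReal_le_of_le_ofReal (by linarith) h2
  rw [h1, add_sub_cancel_right, abs_of_nonneg measureReal_nonneg]
  exact h3

lemma aux_lip (u v : ℝ) :
    |(gaussianReal 0 1).real (Set.Ioi u) - (gaussianReal 0 1).real (Set.Ioi v)| ≤ |u - v| := by
  rcases le_total u v with h | h
  · rw [abs_sub_comm u v, abs_of_nonneg (sub_nonneg.mpr h)]; exact aux_lip' h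
  · rw [abs_sub_comm, abs_of_nonneg (sub_nonneg.mpr h)]; exact aux_lip' h

lemma aux_tail {t : ℝ} (ht : 0 ≤ t) :
    (gaussianReal 0 1).real (Set.Ioi t) ≤ Real.exp (-(t ^ 2) / 2) := by
  have h := measure_ge_le_exp_mul_mgf (μ := gaussianReal 0 1) (X := id) t ht
    (integrable_exp_mul_gaussianReal t)
  rw [mgf_id_gaussianReal, ← Real.exp_add] at h
  refine le_trans (measureReal_mono (s₂ := {ω : ℝ | t ≤ id ω}) (fun x hx => le_of_lt (Set.mem_Ioi.mp hx))) (h.trans (le_of_eq ?_))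
  congr 1
  push_cast
  ring

lemma aux_mean (t : ℝ) : 
    ∫ x in Set.Ioi t, x ∂(gaussianReal 0 1) ≤ Real.exp (-(t ^ 2) / 2) := by
  have hint : Integrable (fun x : ℝ => x * Real.exp (-(1/2) * x^2)) := 
    integrable_mul_exp_neg_mul_sq (by norm_num)
  have h0 : ∫ x in Set.Ioi t, x ∂(gaussianReal 0 1) = 
      ∫ x in Set.Ioi t, (Real.sqrt (2 * Real.pi))⁻¹ * (x * Real.exp (-(1/2) * x^2)) := by
    rw [gaussianReal_of_var_ne_zero 0 one_ne_zero, 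
      setIntegral_withDensity_eq_setIntegral_toReal_smul (measurable_gaussianPDF 0 1)
       (by simp [gaussianPDF_lt_top]) _ measurableSet_Ioi]
    congr 1
    ext x
    rw [toReal_gaussianPDF, aux_pdf, smul_eq_mul]
    ring_nf
  have h1 : ∫ x in Set.Ioi t, (x * Real.exp (-(1/2) * x^2)) = 0 - (- Real.exp (-(1/2) * t^2)) := by
    refine integral_Ioi_of_hasDerivAt_of_tendsto' (f := fun x => - Real.exp (-(1/2) * x^2)) (fun x _ => ?_) hint.integrableOn ?_
    · have := (((hasDerivAt_pow 2 x).const_mul (-(1/2):ℝ)).exp).neg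
      refine this.congr_deriv ?_
      push_cast
      ring
    · rw [← neg_zero]
      refine Tendsto.neg ?_
      refine Real.tendsto_exp_atBot.comp ?_
      exact (tendsto_pow_atTop (two_ne_zero)).const_mul_atTop_of_neg (by norm_num)
  rw [h0, integral_const_mul, h1, zero_sub, neg_neg]
  calc _ ≤ 1 * Real.exp (-(1/2) * t^2) := by gcongr; exact aux_inv
    _ = _ := by rw [one_mul]; congr 1; ring

lemma aux_indep {Ω : Type*} [MeasurableSpace Ω] {μ : Measure Ω} [IsProbabilityMeasure μ]
    {X Z : Ω → ℝ} (hX : Measurable X) (hZ : Measurable Z)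
    (h : ∀ a b : ℝ, μ.map (fun ω => a * X ω + b * Z ω) = gaussianReal 0 (a^2 + b^2).toNNReal) :
    IndepFun X Z μ := by
  rw [indepFun_iff_charFunDual_prod hX.aemeasurable hZ.aemeasurable]
  intro L
  have hL : ∀ x z : ℝ, L (x, z) = L (1, 0) * x + L (0, 1) * z := by
    intro x z
    have : ((x, z) : ℝ × ℝ) = x • (1, 0) + z • (0, 1) := by simp
    rw [this, map_add, map_smul, map_smul, smul_eq_mul, smul_eq_mul]; ring
  rw [charFunDual_eq_charFun_map_one, charFunDual_eq_charFun_map_one, 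
    charFunDual_eq_charFun_map_one, Measure.map_map (by fun_prop) (by fun_prop), 
    Measure.map_map (by fun_prop) (by fun_prop), Measure.map_map (by fun_prop) (by fun_prop)]
  have e1 : (L ∘ fun ω => (X ω, Z ω)) = fun ω => L (1, 0) * X ω + L (0, 1) * Z ω := by
    ext ω; exact hL _ _
  have e2 : ((L.comp (.inl ℝ ℝ ℝ)) ∘ X) = fun ω => L (1, 0) * X ω + 0 * Z ω := by
    ext ω; simp [hL (X ω) 0]
  have e3 : ((L.comp (.inr ℝ ℝ ℝ)) ∘ Z) = fun ω => 0 * X ω + L (0, 1) * Z ω := by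
    ext ω; simp [hL 0 (Z ω)]
  rw [e1, e2, e3, h, h, h, charFun_gaussianReal, charFun_gaussianReal, charFun_gaussianReal,
    ← Complex.exp_add]
  congr 1
  rw [Real.coe_toNNReal _ (by positivity), Real.coe_toNNReal _ (by positivity), 
    Real.coe_toNNReal _ (by positivity)]
  push_cast
  ring

lemma aux_num {ρ t x : ℝ} (hρ : |ρ| ≤ 1/2) (ht : 0 ≤ t) (hx : t < x) :
    |(t - ρ * x) / Real.sqrt (1 - ρ^2) - t| ≤ 3 * |ρ| * x := by
  set s := Real.sqrt (1 - ρ^2) with hs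
  have h2 : ρ^2 = |ρ|^2 := (sq_abs ρ).symm
  have hr0 := abs_nonneg ρ
  have hs2 : s^2 = 1 - |ρ|^2 := by rw [hs, Real.sq_sqrt, h2]; nlinarith
  have hs1 : 4/5 ≤ s := by
    apply Real.le_sqrt_of_sq_le; nlinarith
  have hs3 : s ≤ 1 := by nlinarith
  have hs0 : 0 < s := by linarith
  have e : (t - ρ * x) / s - t = (t * (1 - s) - ρ * x) / s := by field_simp; ring
  rw [e, abs_div, abs_of_pos hs0, div_le_iff₀ hs0]
  have hx0 : 0 ≤ x := by linarith
  have h3 : 1 - s ≤ |ρ| := by nlinarith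
  calc |t * (1 - s) - ρ * x| ≤ |t * (1 - s)| + |ρ * x| := abs_sub _ _
    _ = t * (1 - s) + |ρ| * x := by 
      rw [abs_mul ρ, abs_of_nonneg hx0, abs_of_nonneg (mul_nonneg ht (by linarith))]
    _ ≤ x * |ρ| + |ρ| * x := by
      gcongr
    _ ≤ _ := by nlinarith [mul_nonneg hr0 hx0]

lemma aux_small {Ω : Type*} [MeasurableSpace Ω] {μ : Measure Ω} [IsProbabilityMeasure μ]
    {X Y : Ω → ℝ} (hX : Measurable X) (hY : Measurable Y) {ρ t : ℝ} (hρ : |ρ| ≤ 1/2) (ht : 0 ≤ t)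
    (h : ∀ a b : ℝ, μ.map (fun ω => a * X ω + b * Y ω) =
      gaussianReal 0 (a^2 + 2 * a * b * ρ + b^2).toNNReal) :
    |μ.real {ω | t < X ω ∧ t < Y ω} - μ.real {ω | t < X ω} * μ.real {ω | t < Y ω}|
      ≤ 3 * |ρ| * Real.exp (-(t ^ 2) / 2) := by
  set s := Real.sqrt (1 - ρ^2) with hs
  set γ := gaussianReal 0 1 with hγ
  have hpos : 0 < 1 - ρ^2 := by nlinarith [sq_abs ρ, abs_nonneg ρ]
  have hs0 : 0 < s := Real.sqrt_pos.mpr hpos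
  have hs2 : s^2 = 1 - ρ^2 := Real.sq_sqrt hpos.le
  let Z : Ω → ℝ := fun ω => (Y ω - ρ * X ω) / s
  have hZ : Measurable Z := by fun_prop
  have hXZ : ∀ a b : ℝ, μ.map (fun ω => a * X ω + b * Z ω) = gaussianReal 0 (a^2 + b^2).toNNReal := by
    intro a b
    have e : (fun ω => a * X ω + b * Z ω) = fun ω => (a - b * ρ / s) * X ω + (b / s) * Y ω := by
      ext ω; simp only [Z]; field_simp; ring
    rw [e, h]
    congr 2
    field_simp
    linear_combination - b^2 * hs2
  have hlX : μ.map X = γ := by simpa using h 1 0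
  have hlY : μ.map Y = γ := by simpa using h 0 1
  have hlZ : μ.map Z = γ := by simpa using hXZ 0 1
  have hind := (indepFun_iff_map_prod_eq_prod_map_map hX.aemeasurable hZ.aemeasurable).mp
    (aux_indep hX hZ hXZ)
  rw [hlX, hlZ] at hind
  have pX : μ.real {ω | t < X ω} = γ.real (Set.Ioi t) := by
    rw [← hlX, map_measureReal_apply hX measurableSet_Ioi]; rfl
  have pY : μ.real {ω | t < Y ω} = γ.real (Set.Ioi t) := by
    rw [← hlY, map_measureReal_apply hY measurableSet_Ioi]; rfl
  let A : Set (ℝ × ℝ) := {p | t < p.1 ∧ t < ρ * p.1 + s * p.2}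
  have hA : MeasurableSet A :=
    (measurableSet_lt measurable_const measurable_fst).inter
      (measurableSet_lt measurable_const
        ((measurable_fst.const_mul ρ).add (measurable_snd.const_mul s)))
  have pXY : μ.real {ω | t < X ω ∧ t < Y ω} = 
      ∫ x in Set.Ioi t, γ.real (Set.Ioi ((t - ρ * x) / s)) ∂γ := by
    have e : {ω | t < X ω ∧ t < Y ω} = (fun ω => (X ω, Z ω)) ⁻¹' A := by
      ext ω
      have : ρ * X ω + s * Z ω = Y ω := by simp only [Z]; field_simp; ring
      simp [A, this]
    rw [e, ← map_measureReal_apply (hX.prodMk hZ) hA, hind, measureReal_def, 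
      Measure.prod_apply hA, ← integral_toReal (measurable_measure_prodMk_left hA).aemeasurable
        (by simp), ← integral_indicator measurableSet_Ioi]
    congr 1
    ext x
    by_cases hx : t < x
    · rw [Set.indicator_of_mem (by exact hx), measureReal_def]
      congr 2
      ext z
      simp only [A, Set.mem_preimage, Set.mem_setOf_eq, hx, true_and, Set.mem_Ioi]
      rw [div_lt_iff₀ hs0]
      constructor <;> intro h <;> linarith
    · rw [Set.indicator_of_notMem (by exact hx)]
      simp [A, hx]
  have hidint : IntegrableOn (fun x : ℝ => x) (Set.Ioi t) γ := 
    ((memLp_id_gaussianReal 1).integrable (by simp)).integrableOn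
  have hmeas : Measurable (fun x : ℝ => γ.real (Set.Ioi ((t - ρ * x) / s))) := by
    have : Antitone (fun u => γ.real (Set.Ioi u)) := 
      fun u v huv => measureReal_mono (Set.Ioi_subset_Ioi huv)
    exact this.measurable.comp (by fun_prop)
  have hint : IntegrableOn (fun x : ℝ => γ.real (Set.Ioi ((t - ρ * x) / s))) (Set.Ioi t) γ := by
    refine Integrable.of_bound hmeas.aestronglyMeasurable 1 (ae_of_all _ fun x => ?_)
    rw [Real.norm_of_nonneg measureReal_nonneg]
    exact measureReal_le_one
  have hconst : γ.real (Set.Ioi t) * γ.real (Set.Ioi t) = ∫ x in Set.Ioi t, γ.real (Set.Ioi t) ∂γ := by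
    simp
  rw [pX, pY, pXY, hconst, ← integral_sub hint (by simp)]
  calc _ ≤ ∫ x in Set.Ioi t, 3 * |ρ| * x ∂γ := by
        rw [← Real.norm_eq_abs]
        refine norm_integral_le_of_norm_le (hidint.const_mul _) ?_
        filter_upwards [ae_restrict_mem measurableSet_Ioi] with x hx
        exact (aux_lip _ _).trans (aux_num hρ ht hx)
    _ = 3 * |ρ| * ∫ x in Set.Ioi t, x ∂γ := integral_const_mul _ _
    _ ≤ _ := by gcongr; exact aux_mean t

lemma aux_all {Ω : Type*} [MeasurableSpace Ω] {μ : Measure Ω} [IsProbabilityMeasure μ]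
    {X Y : Ω → ℝ} (hX : Measurable X) (hY : Measurable Y) {ρ t : ℝ} (ht : 0 ≤ t)
    (h : ∀ a b : ℝ, μ.map (fun ω => a * X ω + b * Y ω) =
      gaussianReal 0 (a^2 + 2 * a * b * ρ + b^2).toNNReal) :
    |μ.real {ω | t < X ω ∧ t < Y ω} - μ.real {ω | t < X ω} * μ.real {ω | t < Y ω}|
      ≤ 3 * |ρ| * Real.exp (-(t ^ 2) / 2) := by
  rcases le_total |ρ| (1/2) with hρ | hρ
  · exact aux_small hX hY hρ ht h
  have hlX : μ.map X = gaussianReal 0 1 := by simpa using h 1 0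
  have pX : μ.real {ω | t < X ω} ≤ Real.exp (-(t ^ 2) / 2) := by
    refine le_trans (le_of_eq ?_) (aux_tail ht)
    rw [← hlX, map_measureReal_apply hX measurableSet_Ioi]; rfl
  have h1 : μ.real {ω | t < X ω ∧ t < Y ω} ≤ μ.real {ω | t < X ω} := 
    measureReal_mono fun ω hω => hω.1
  have h2 : μ.real {ω | t < X ω} * μ.real {ω | t < Y ω} ≤ μ.real {ω | t < X ω} :=
    mul_le_of_le_one_right measureReal_nonneg measureReal_le_one
  have h3 : 0 ≤ μ.real {ω | t < X ω ∧ t < Y ω} := measureReal_nonneg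
  have h4 : 0 ≤ μ.real {ω | t < X ω} * μ.real {ω | t < Y ω} := by positivity
  have h5 := Real.exp_pos (-(t ^ 2) / 2)
  rw [abs_le]
  constructor <;> nlinarith

lemma aux_cov {Ω : Type*} [MeasurableSpace Ω] {μ : Measure Ω} [IsProbabilityMeasure μ]
    {X Y : Ω → ℝ} (hX : Measurable X) (hY : Measurable Y) {ρ t : ℝ} (ht : 0 ≤ t)
    (h : ∀ a b : ℝ, μ.map (fun ω => a * X ω + b * Y ω) =
      gaussianReal 0 (a^2 + 2 * a * b * ρ + b^2).toNNReal)
    (mX : MemLp (fun ω => if t < X ω then (1:ℝ) else 0) 2 μ)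
    (mY : MemLp (fun ω => if t < Y ω then (1:ℝ) else 0) 2 μ) :
    covariance (fun ω => if t < X ω then (1:ℝ) else 0) (fun ω => if t < Y ω then (1:ℝ) else 0) μ
      ≤ 3 * |ρ| * Real.exp (-(t ^ 2) / 2) := by
  have key : ∀ S : Set Ω, MeasurableSet S → ∀ f : Ω → ℝ, f = S.indicator 1 → ∫ ω, f ω ∂μ = μ.real S := by
    rintro S hS f rfl
    exact integral_indicator_one hS
  have sX : MeasurableSet {ω | t < X ω} := measurableSet_lt measurable_const hX
  have sY : MeasurableSet {ω | t < Y ω} := measurableSet_lt measurable_const hY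
  have e1 := key _ sX (fun ω => if t < X ω then (1:ℝ) else 0) (by ext ω; simp [Set.indicator])
  have e2 := key _ sY (fun ω => if t < Y ω then (1:ℝ) else 0) (by ext ω; simp [Set.indicator])
  have e3 := key _ (sX.inter sY)
    ((fun ω => if t < X ω then (1:ℝ) else 0) * (fun ω => if t < Y ω then (1:ℝ) else 0)) (by
      ext ω
      by_cases h1 : t < X ω <;> by_cases h2 : t < Y ω <;> simp [h1, h2, Set.indicator])
  rw [covariance_eq_sub mX mY, e1, e2, e3]
  exact (le_abs_self _).trans (aux_all hX hY ht h)

/-- variance bound for the exceedance count (Lemma A.5). -/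
theorem stmt5 :
    ∃ C : ℝ, 0 < C ∧ ∀ m : ℕ, 1 ≤ m →
      ∀ (S : Matrix (Fin m) (Fin m) ℝ), IsCorrMatrix S →
      ∀ (Ω : Type) [MeasureSpace Ω] [IsProbabilityMeasure (volume : Measure Ω)]
        (x0 : Ω → Fin m → ℝ), HasLawGaussian x0 0 S →
      ∀ t : ℝ, 0 ≤ t →
      variance (fun ω => exceedCount (x0 ω) t) volume
        ≤ C * (∑ i, ∑ j, |S i j|) * Real.exp (-(t ^ 2) / 2) := by
  refine ⟨3, by norm_num, ?_⟩
  intro m _ S hS Ω _ _ x0 hx t ht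
  have hmem : ∀ i, MemLp (fun ω => if t < x0 ω i then (1:ℝ) else 0) 2 (volume : Measure Ω) := by
    intro i
    refine MemLp.of_bound (Measurable.aestronglyMeasurable ?_) 1 (ae_of_all _ fun ω => ?_)
    · exact Measurable.ite (measurableSet_lt measurable_const (hx.1 i)) measurable_const
        measurable_const
    · split_ifs <;> simp
  have hpair : ∀ i j, ∀ a b : ℝ, (volume : Measure Ω).map (fun ω => a * x0 ω i + b * x0 ω j) =
      gaussianReal 0 (a^2 + 2 * a * b * S i j + b^2).toNNReal := by
    intro i j a b
    have h := hx.2 (fun k => (if k = i then a else 0) + (if k = j then b else 0))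
    have hsym : S j i = S i j := by
      have := hS.1.1.apply i j
      simpa using this
    have e : (∑ k, ∑ l, ((if k = i then a else 0) + (if k = j then b else 0)) * S k l *
        ((if l = i then a else 0) + (if l = j then b else 0)))
        = a^2 + 2 * a * b * S i j + b^2 := by
      simp only [add_mul, mul_add, Finset.sum_add_distrib, mul_ite, ite_mul, zero_mul, mul_zero,
        Finset.sum_ite_eq', Finset.mem_univ, if_true, Finset.sum_ite_irrel, Finset.sum_const_zero]
      rw [hS.2 i, hS.2 j, hsym]
      ring
    rw [e] at h
    simpa [add_mul, Finset.sum_add_distrib] using h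
  simp only [exceedCount]
  rw [variance_fun_sum hmem, Finset.mul_sum, Finset.sum_mul]
  refine Finset.sum_le_sum fun i _ => ?_
  rw [Finset.mul_sum, Finset.sum_mul]
  exact Finset.sum_le_sum fun j _ =>
    aux_cov (hx.1 i) (hx.1 j) ht (hpair i j) (hmem i) (hmem j)


end
end
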